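/- The 24-term inhomogeneous 4-chain Ω of G×G, taken with ℤ₂-coefficients, is a cycle, and its homology class in H₄(G×G; ℤ₂) is nonzero (it represents the ℤ₂-fundamental class of K×K). -/

import Mathlib

set_option maxSynthPendingDepth 5

def kbRels : Set (FreeGroup (Fin 2)) :=
  {FreeGroup.of 1 * FreeGroup.of 0 * FreeGroup.of 1 * (FreeGroup.of 0)⁻¹}

/-- The Klein bottle group `G = ⟨x, y ∣ yxy = x⟩`. -/
abbrev KG := PresentedGroup kbRels

def kx : KG := PresentedGroup.of 0
def ky : KG := PresentedGroup.of 1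

/-- The differential of the inhomogeneous (bar) chain complex of `π` with trivial
`ℤ₂`-coefficients, from `(n+1)`-chains to `n`-chains. -/
noncomputable def barD (π : Type) [Group π] (n : ℕ) :
    ((Fin (n + 1) → π) →₀ ZMod 2) →ₗ[ZMod 2] ((Fin n → π) →₀ ZMod 2) :=
  Finsupp.lsum (ZMod 2) fun g =>
    LinearMap.toSpanSingleton (ZMod 2) _
      (Finsupp.single (fun j => g j.succ) 1
        + ∑ i : Fin n, Finsupp.single (Fin.contractNth (Fin.castSucc i) (· * ·) g) 1
        + Finsupp.single (fun j => g (Fin.castSucc j)) 1)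

def x1 : KG × KG := (kx, 1)
def x2 : KG × KG := (1, kx)
def y1 : KG × KG := (ky, 1)
def y2 : KG × KG := (1, ky)

/-- The 24-term inhomogeneous 4-chain `Ω` of `G × G` with `ℤ₂`-coefficients
(the Eilenberg–Zilber image of `κ ⊗ κ`; signs are discarded mod 2). -/
noncomputable def Omega : (Fin 4 → KG × KG) →₀ ZMod 2 :=
    Finsupp.single ![y1, x1, y2, x2] 1
  + Finsupp.single ![y1, y2, x1, x2] 1
  + Finsupp.single ![y1, y2, x2, x1] 1
  + Finsupp.single ![y2, y1, x1, x2] 1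
  + Finsupp.single ![y2, y1, x2, x1] 1
  + Finsupp.single ![y2, x2, y1, x1] 1
  + Finsupp.single ![y1, x1, y2 * x2, y2] 1
  + Finsupp.single ![y1, y2 * x2, x1, y2] 1
  + Finsupp.single ![y1, y2 * x2, y2, x1] 1
  + Finsupp.single ![y2 * x2, y1, x1, y2] 1
  + Finsupp.single ![y2 * x2, y1, y2, x1] 1
  + Finsupp.single ![y2 * x2, y2, y1, x1] 1
  + Finsupp.single ![y1 * x1, y1, y2, x2] 1
  + Finsupp.single ![y1 * x1, y2, y1, x2] 1
  + Finsupp.single ![y1 * x1, y2, x2, y1] 1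
  + Finsupp.single ![y2, y1 * x1, y1, x2] 1
  + Finsupp.single ![y2, y1 * x1, x2, y1] 1
  + Finsupp.single ![y2, x2, y1 * x1, y1] 1
  + Finsupp.single ![y1 * x1, y1, y2 * x2, y2] 1
  + Finsupp.single ![y1 * x1, y2 * x2, y1, y2] 1
  + Finsupp.single ![y1 * x1, y2 * x2, y2, y1] 1
  + Finsupp.single ![y2 * x2, y1 * x1, y1, y2] 1
  + Finsupp.single ![y2 * x2, y1 * x1, y2, y1] 1
  + Finsupp.single ![y2 * x2, y2, y1 * x1, y1] 1

lemma ky_mul_kx_mul_ky : ky * kx * ky = kx := by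
  have h : (PresentedGroup.mk kbRels
      (FreeGroup.of 1 * FreeGroup.of 0 * FreeGroup.of 1 * (FreeGroup.of 0)⁻¹)) = 1 :=
    PresentedGroup.one_of_mem rfl
  rw [map_mul, map_inv, mul_inv_eq_one] at h
  exact h

lemma barD_single (π : Type) [Group π] (n : ℕ) (g : Fin (n + 1) → π) :
    barD π n (Finsupp.single g 1) = Finsupp.single (fun j => g j.succ) 1
        + ∑ i : Fin n, Finsupp.single (Fin.contractNth (Fin.castSucc i) (· * ·) g) 1
        + Finsupp.single (fun j => g (Fin.castSucc j)) 1 := by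
  simp [barD]

lemma barD_three_single {π : Type} [Group π] (a b c d : π) :
    barD π 3 (Finsupp.single ![a, b, c, d] 1) =
      Finsupp.single ![b, c, d] 1 + Finsupp.single ![a * b, c, d] 1
        + Finsupp.single ![a, b * c, d] 1 + Finsupp.single ![a, b, c * d] 1
        + Finsupp.single ![a, b, c] 1 := by
  rw [barD_single, Fin.sum_univ_three]
  simp only [← add_assoc]
  congr <;> funext j <;> fin_cases j <;> rfl

lemma barD_three_Omega : barD (KG × KG) 3 Omega = 0 := by
  have hr₁ : y1 * x1 * y1 = x1 := by simp [x1, y1, ky_mul_kx_mul_ky]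
  have hr₂ : y2 * x2 * y2 = x2 := by simp [x2, y2, ky_mul_kx_mul_ky]
  have hxx : x2 * x1 = x1 * x2 := by simp [x1, x2]
  have hxy : x2 * y1 = y1 * x2 := by simp [y1, x2]
  have hyx : y2 * x1 = x1 * y2 := by simp [x1, y2]
  have hyy : y2 * y1 = y1 * y2 := by simp [y1, y2]
  have hpx : y2 * x2 * x1 = x1 * (y2 * x2) := by simp [x1, x2, y2]
  have hpy : y2 * x2 * y1 = y1 * (y2 * x2) := by simp [y1, x2, y2]
  have hxp : x2 * (y1 * x1) = y1 * x1 * x2 := by simp [x1, x2, y1]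
  have hyp : y2 * (y1 * x1) = y1 * x1 * y2 := by simp [x1, y1, y2]
  have hpp : y2 * x2 * (y1 * x1) = y1 * x1 * (y2 * x2) := by simp [x1, x2, y1, y2]
  have two_zsmul_eq_zero (v : (Fin 3 → KG × KG) →₀ ZMod 2) : (2 : ℤ) • v = 0 := by
    rw [two_zsmul, ZModModule.add_self]
  simp only [Omega, map_add, barD_three_single, hr₁, hr₂, hxx, hxy, hyx, hyy, hpx, hpy, hxp, hyp,
    hpp]
  abel_nf
  simp only [two_zsmul_eq_zero, add_zero]

/-- The homomorphism `G → ℤ₂` with prescribed values on the generators `x`, `y`. -/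
def kgHom (v : Fin 2 → ZMod 2) : KG →* Multiplicative (ZMod 2) :=
  PresentedGroup.toGroup (f := fun i => Multiplicative.ofAdd (v i)) (by
    rintro r rfl
    simp only [map_mul, map_inv, FreeGroup.lift_apply_of]
    generalize v 0 = a
    generalize v 1 = b
    revert a b
    decide)

/-- The cup product of four homomorphisms to `ℤ₂`, as a linear functional on bar `4`-chains. -/
noncomputable def cupFour {π : Type} [Group π] (a b c d : π →* Multiplicative (ZMod 2)) :
    ((Fin 4 → π) →₀ ZMod 2) →ₗ[ZMod 2] ZMod 2 :=
  Finsupp.lsum (ZMod 2) fun g => LinearMap.toSpanSingleton (ZMod 2) _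
    ((a (g 0)).toAdd * (b (g 1)).toAdd * (c (g 2)).toAdd * (d (g 3)).toAdd)

lemma cupFour_single {π : Type} [Group π] (a b c d : π →* Multiplicative (ZMod 2))
    (g : Fin 4 → π) : cupFour a b c d (Finsupp.single g 1) =
      (a (g 0)).toAdd * (b (g 1)).toAdd * (c (g 2)).toAdd * (d (g 3)).toAdd := by
  simp [cupFour]

lemma cupFour_barD {π : Type} [Group π] (a b c d : π →* Multiplicative (ZMod 2))
    (z : (Fin 5 → π) →₀ ZMod 2) : cupFour a b c d (barD π 4 z) = 0 := by
  suffices h : cupFour a b c d ∘ₗ barD π 4 = 0 from LinearMap.congr_fun h z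
  ext g
  simp only [LinearMap.comp_apply, Finsupp.lsingle_apply, barD_single, Fin.sum_univ_four, map_add,
    cupFour_single]
  simp [Fin.contractNth]
  grind

lemma cupFour_Omega :
    cupFour ((kgHom ![0, 1]).comp (MonoidHom.fst KG KG)) ((kgHom ![1, 0]).comp (MonoidHom.fst KG KG))
      ((kgHom ![0, 1]).comp (MonoidHom.snd KG KG)) ((kgHom ![1, 0]).comp (MonoidHom.snd KG KG))
      Omega = 1 := by
  have hx (v) : kgHom v kx = Multiplicative.ofAdd (v 0) := PresentedGroup.toGroup.of _
  have hy (v) : kgHom v ky = Multiplicative.ofAdd (v 1) := PresentedGroup.toGroup.of _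
  simp [Omega, cupFour_single, x1, x2, y1, y2, hx, hy]

/-- `Ω` is a cycle and its homology class in `H₄(G×G;ℤ₂)` is nonzero. -/
theorem stmt8 :
    barD (KG × KG) 3 Omega = 0 ∧ Omega ∉ Set.range (barD (KG × KG) 4) := by
  refine ⟨barD_three_Omega, ?_⟩
  rintro ⟨z, hz⟩
  have h := cupFour_Omega
  rw [← hz, cupFour_barD] at h
  exact zero_ne_one h
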